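/- arXiv:1904.08862 — 15 statements merged into one kernel-verified Lean document; each statement's English description precedes it below -/
import Mathlib

section
/- Let a ∈ ℝ and let I ⊆ ℝ be a nonempty open interval. Suppose s : ℝ → ℝ is twice differentiable on I and satisfies the Euler–Lagrange equation 2·s(t)·s''(t) + s'(t)² + a·s(t)² − 1 = 0 for all t ∈ I. Then there exists a constant H ∈ ℝ such that s(t)·(s'(t)² + (a/3)·s(t)² − 1) = H for all t ∈ I. -/
theorem hasDerivAt_first_integral {a t v w : ℝ} {s s' : ℝ → ℝ}
    (hs : HasDerivAt s v t) (hs' : HasDerivAt s' w t) (hv : s' t = v) :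
    HasDerivAt (fun t => s t * ((s' t) ^ 2 + a / 3 * (s t) ^ 2 - 1))
      (v * (2 * s t * w + v ^ 2 + a * (s t) ^ 2 - 1)) t := by
  refine (hs.fun_mul
    (((hs'.fun_pow 2).fun_add ((hs.fun_pow 2).const_mul (a / 3))).sub_const 1)).congr_deriv ?_
  simp only [hv]
  push_cast
  ring


/-- If a twice differentiable scale function `s` satisfies the Euler–Lagrange equation
`2·s·s'' + s'² + a·s² − 1 = 0` on a nonempty open interval `I`, then there is a constant `H`
with `s·(s'² + (a/3)·s² − 1) = H` on `I`. -/
theorem stmt_0 (a : ℝ) (I : Set ℝ) (hIopen : IsOpen I) (hIne : I.Nonempty)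
    (hIconn : I.OrdConnected)
    (s s' s'' : ℝ → ℝ)
    (hs' : ∀ t ∈ I, HasDerivAt s (s' t) t)
    (hs'' : ∀ t ∈ I, HasDerivAt s' (s'' t) t)
    (hEL : ∀ t ∈ I, 2 * s t * s'' t + (s' t) ^ 2 + a * (s t) ^ 2 - 1 = 0) :
    ∃ H : ℝ, ∀ t ∈ I, s t * ((s' t) ^ 2 + a / 3 * (s t) ^ 2 - 1) = H := by
  have hderiv : ∀ t ∈ I,
      HasDerivAt (fun t => s t * ((s' t) ^ 2 + a / 3 * (s t) ^ 2 - 1)) 0 t := fun t ht => by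
    simpa [hEL t ht] using hasDerivAt_first_integral (a := a) (hs' t ht) (hs'' t ht) rfl
  exact hIopen.exists_is_const_of_deriv_eq_zero hIconn.isPreconnected
    (fun t ht => (hderiv t ht).differentiableAt.differentiableWithinAt)
    (fun t ht => (hderiv t ht).deriv)
end

section
/- Let a, Λ ∈ ℝ and let s : ℝ → ℝ be twice differentiable at t with s(t) > 0 and 2·s(t)·s''(t) + s'(t)² + a·s(t)² − 1 = 0. Define the pressure p(t) = −(1/(4π·s(t)))·(s''(t) + (s'(t)² + 1)/(2·s(t)) − Λ·s(t)/2). Then Λ + a − 8π·p(t) = 2/s(t)²; in particular Λ + a − 8π·p(t) > 0 and s(t)² = 2/(Λ + a − 8π·p(t)). -/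
open Real

/-- For a scale function satisfying the Euler–Lagrange equation at a point `t` with
`s t > 0`, the pressure `p = −(1/(4π·s))·(s'' + (s'² + 1)/(2s) − Λ·s/2)` satisfies
`Λ + a − 8π·p = 2/s²`; in particular `Λ + a − 8π·p > 0` and `s² = 2/(Λ + a − 8π·p)`. -/
theorem stmt_2 (a Λ : ℝ) (s : ℝ → ℝ) (t : ℝ)
    (h1 : DifferentiableAt ℝ s t) (h2 : DifferentiableAt ℝ (deriv s) t)
    (hspos : s t > 0)
    (hEL : 2 * s t * deriv (deriv s) t + (deriv s t) ^ 2 + a * (s t) ^ 2 - 1 = 0)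
    (p : ℝ)
    (hp : p = -(1 / (4 * π * s t)) *
      (deriv (deriv s) t + ((deriv s t) ^ 2 + 1) / (2 * s t) - Λ * s t / 2)) :
    Λ + a - 8 * π * p = 2 / (s t) ^ 2 ∧
      Λ + a - 8 * π * p > 0 ∧
      (s t) ^ 2 = 2 / (Λ + a - 8 * π * p) := by
  have key : Λ + a - 8 * π * p = 2 / (s t) ^ 2 := by
    have hs : s t ≠ 0 := hspos.ne'
    have hπ : π ≠ 0 := Real.pi_ne_zero
    have h8p : 8 * π * p =
        Λ - (2 * s t * deriv (deriv s) t + (deriv s t) ^ 2 + 1) / (s t) ^ 2 := by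
      rw [hp]
      field_simp
      ring
    rw [h8p]
    field_simp
    linarith
  refine ⟨key, ?_, ?_⟩
  · rw [key]
    positivity
  · rw [key]
    field_simp
end

section
/- Let a, H, Λ ∈ ℝ and let s : ℝ → ℝ be twice differentiable at t with s(t) > 0. Assume the Euler–Lagrange equation 2·s(t)·s''(t) + s'(t)² + a·s(t)² − 1 = 0 and the first-integral equation s(t)·(s'(t)² + (a/3)·s(t)² − 1) = H both hold at t. Define m(t) = (3/(8π))·(s'(t)²/s(t)² + 1/s(t)² − Λ/3) and p(t) = −(1/(4π·s(t)))·(s''(t) + (s'(t)² + 1)/(2·s(t)) − Λ·s(t)/2). Then Λ + a − 8π·p(t) > 0 and the equation of state (8π/3)·m(t) + 8π·p(t) − (2/3)·(Λ + a) − (H/(2·√2))·(Λ + a − 8π·p(t))^{3/2} = 0 holds. -/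
open Real

/-- The equation of state of an m-critical RW spacetime: if the Euler–Lagrange equation and
the first-integral equation hold at `t` and `s t > 0`, then `Λ + a − 8π·p > 0` and
`(8π/3)·m + 8π·p − (2/3)·(Λ + a) − (H/(2√2))·(Λ + a − 8π·p)^(3/2) = 0`. -/
theorem stmt_3 (a H Λ : ℝ) (s : ℝ → ℝ) (t : ℝ)
    (h1 : DifferentiableAt ℝ s t) (h2 : DifferentiableAt ℝ (deriv s) t)
    (hspos : s t > 0)
    (hEL : 2 * s t * deriv (deriv s) t + (deriv s t) ^ 2 + a * (s t) ^ 2 - 1 = 0)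
    (hFI : s t * ((deriv s t) ^ 2 + a / 3 * (s t) ^ 2 - 1) = H)
    (m p : ℝ)
    (hm : m = 3 / (8 * π) * ((deriv s t) ^ 2 / (s t) ^ 2 + 1 / (s t) ^ 2 - Λ / 3))
    (hp : p = -(1 / (4 * π * s t)) *
      (deriv (deriv s) t + ((deriv s t) ^ 2 + 1) / (2 * s t) - Λ * s t / 2)) :
    Λ + a - 8 * π * p > 0 ∧
      8 * π / 3 * m + 8 * π * p - 2 / 3 * (Λ + a)
        - H / (2 * Real.sqrt 2) * (Λ + a - 8 * π * p) ^ ((3 : ℝ) / 2) = 0 := by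
  have hpi : π ≠ 0 := Real.pi_ne_zero
  have hs : s t ≠ 0 := hspos.ne'
  have hpressure : 8 * π * p = Λ + a - 2 / (s t) ^ 2 := by
    rw [hp]
    field_simp
    linear_combination (-8) * hEL
  have hmass : 8 * π / 3 * m = ((deriv s t) ^ 2 + 1) / (s t) ^ 2 - Λ / 3 := by
    rw [hm]
    field_simp
  have hgap : Λ + a - 8 * π * p = 2 / (s t) ^ 2 := by
    rw [hpressure]
    ring
  have hsqrt : Real.sqrt 2 ≠ 0 := by positivity
  have hpow : (2 / (s t) ^ 2) ^ ((3 : ℝ) / 2) = 2 * Real.sqrt 2 / (s t) ^ 3 := by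
    have hsq : 2 / (s t) ^ 2 = (Real.sqrt 2 / s t) ^ (2 : ℝ) := by
      rw [Real.rpow_two, div_pow, Real.sq_sqrt zero_le_two]
    have hcube : Real.sqrt 2 ^ 3 = 2 * Real.sqrt 2 := by
      rw [pow_succ, Real.sq_sqrt zero_le_two]
    rw [hsq, ← Real.rpow_mul (by positivity), show (2 : ℝ) * (3 / 2) = (3 : ℕ) by norm_num,
      Real.rpow_natCast, div_pow, hcube]
  refine ⟨by rw [hgap]; positivity, ?_⟩
  rw [hgap, hpow, hmass, hpressure, ← hFI]
  field_simp
  ring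
end

section
/- Let a ∈ ℝ, H ≠ 0, and let S : ℝ → ℝ be differentiable at τ with S(τ) ≠ 0. Define Q(τ) = H/(4·S(τ)) + 1/12. Then S'(τ)² + (a/3)·S(τ)⁴ − S(τ)² − H·S(τ) = 0 holds if and only if Q'(τ)² = 4·Q(τ)³ − (1/12)·Q(τ) + (1/48)·(2/9 − a·H²) holds. -/
/-- For `H ≠ 0` and `S` differentiable at `τ` with `S τ ≠ 0`, setting
`Q = H/(4S) + 1/12`, the conformal variational equation
`S'² + (a/3)·S⁴ − S² − H·S = 0` holds at `τ` if and only if the Weierstrass-type equation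
`Q'² = 4Q³ − (1/12)Q + (1/48)(2/9 − a·H²)` holds at `τ`. -/
theorem stmt_5 (a H : ℝ) (hH : H ≠ 0) (S : ℝ → ℝ) (τ : ℝ)
    (hS : DifferentiableAt ℝ S τ) (hSτ : S τ ≠ 0) :
    ((deriv S τ) ^ 2 + a / 3 * (S τ) ^ 4 - (S τ) ^ 2 - H * S τ = 0) ↔
      ((deriv (fun x => H / (4 * S x) + 1 / 12) τ) ^ 2 =
        4 * (H / (4 * S τ) + 1 / 12) ^ 3 - 1 / 12 * (H / (4 * S τ) + 1 / 12)
          + 1 / 48 * (2 / 9 - a * H ^ 2)) := by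
  have hQ : deriv (fun x => H / (4 * S x) + 1 / 12) τ = -(H * deriv S τ) / (4 * S τ ^ 2) := by
    have h4 : (4 * S τ) ≠ 0 := mul_ne_zero four_ne_zero hSτ
    have h := ((hasDerivAt_const τ H).fun_div (hS.hasDerivAt.const_mul 4) h4).add_const (1 / 12)
    rw [h.deriv]
    field_simp
    ring
  have key : (-(H * deriv S τ) / (4 * S τ ^ 2)) ^ 2 -
      (4 * (H / (4 * S τ) + 1 / 12) ^ 3 - 1 / 12 * (H / (4 * S τ) + 1 / 12)
        + 1 / 48 * (2 / 9 - a * H ^ 2)) =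
      H ^ 2 / (16 * S τ ^ 4) *
        ((deriv S τ) ^ 2 + a / 3 * (S τ) ^ 4 - (S τ) ^ 2 - H * S τ) := by
    field_simp
    ring
  have hc : H ^ 2 / (16 * S τ ^ 4) ≠ 0 := by positivity
  rw [hQ, ← sub_eq_zero (b := _ + _), key, mul_eq_zero, or_iff_right hc]
end

section
/- Let a, H, Λ ∈ ℝ with H ≠ 0, and let S : ℝ → ℝ be twice differentiable at τ with S(τ) > 0. Assume S'(τ)² + (a/3)·S(τ)⁴ − S(τ)² − H·S(τ) = 0 and S''(τ) = −(2a/3)·S(τ)³ + S(τ) + H/2. Define m̃(τ) = (3/(8π))·(S'(τ)²/S(τ)⁴ + 1/S(τ)² − Λ/3), p̃(τ) = −(1/(4π·S(τ)))·(S''(τ)/S(τ)² − S'(τ)²/(2·S(τ)³) + 1/(2·S(τ)) − Λ·S(τ)/2), and Q(τ) = H/(4·S(τ)) + 1/12. Then m̃(τ) = (3/(8π))·(2/S(τ)² + H/S(τ)³ − (a+Λ)/3) = (1/(8π))·((1 − 12·Q(τ))²·(5 + 12·Q(τ))/(9·H²) − a − Λ) and p̃(τ) = (1/(4π))·((a+Λ)/2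 − 1/S(τ)²) = (1/(4π))·((a+Λ)/2 − (12·Q(τ) − 1)²/(9·H²)). -/
open Real

/-- Expressions of the conformal energy density and conformal pressure of an m-critical RW
universe in terms of the conformal scale function `S` and of `Q = H/(4S) + 1/12`. -/
theorem stmt_6 (a H Λ : ℝ) (hH : H ≠ 0) (S : ℝ → ℝ) (τ : ℝ)
    (h1 : DifferentiableAt ℝ S τ) (h2 : DifferentiableAt ℝ (deriv S) τ)
    (hSpos : S τ > 0)
    (hVE : (deriv S τ) ^ 2 + a / 3 * (S τ) ^ 4 - (S τ) ^ 2 - H * S τ = 0)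
    (hVE' : deriv (deriv S) τ = -(2 * a / 3) * (S τ) ^ 3 + S τ + H / 2)
    (m p Q : ℝ)
    (hm : m = 3 / (8 * π) * ((deriv S τ) ^ 2 / (S τ) ^ 4 + 1 / (S τ) ^ 2 - Λ / 3))
    (hp : p = -(1 / (4 * π * S τ)) *
      (deriv (deriv S) τ / (S τ) ^ 2 - (deriv S τ) ^ 2 / (2 * (S τ) ^ 3)
        + 1 / (2 * S τ) - Λ * S τ / 2))
    (hQ : Q = H / (4 * S τ) + 1 / 12) :
    m = 3 / (8 * π) * (2 / (S τ) ^ 2 + H / (S τ) ^ 3 - (a + Λ) / 3) ∧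
    m = 1 / (8 * π) * ((1 - 12 * Q) ^ 2 * (5 + 12 * Q) / (9 * H ^ 2) - a - Λ) ∧
    p = 1 / (4 * π) * ((a + Λ) / 2 - 1 / (S τ) ^ 2) ∧
    p = 1 / (4 * π) * ((a + Λ) / 2 - (12 * Q - 1) ^ 2 / (9 * H ^ 2)) := by
  have hS : S τ ≠ 0 := hSpos.ne'
  have hπ : π ≠ 0 := pi_ne_zero
  have hsq : (deriv S τ) ^ 2 = (S τ) ^ 2 + H * S τ - a / 3 * (S τ) ^ 4 := by linarith
  have hQS : 12 * Q - 1 = 3 * H / S τ := by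
    rw [hQ]
    field_simp
    ring
  have hQS' : 1 - 12 * Q = -(3 * H / S τ) := by linarith
  have hQS'' : 5 + 12 * Q = 6 + 3 * H / S τ := by linarith
  rw [hQS, hQS', hQS'', hm, hp, hsq, hVE']
  refine ⟨?_, ?_, ?_, ?_⟩ <;>
  · field_simp
    ring
end

section
/- Let H > 0 and set a = 4/(9·H²) (so that a·H² = 4/9). For every τ ∈ ℝ with cos(τ/2) ≠ 0, the function S(τ) = 3H/(3·tan²(τ/2) + 1) is differentiable at τ and satisfies S'(τ)² + (a/3)·S(τ)⁴ − S(τ)² − H·S(τ) = 0. -/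
open Real

/-- Derivative of `S(τ) = 3H/(3·tan²(τ/2) + 1)`, expressed through `tan (τ/2)`. -/
theorem hasDerivAt_div_three_mul_tan_half_sq_add_one (H : ℝ) {τ : ℝ} (hτ : Real.cos (τ / 2) ≠ 0) :
    HasDerivAt (fun u => 3 * H / (3 * Real.tan (u / 2) ^ 2 + 1))
      (-(9 * H * Real.tan (τ / 2) * (1 + Real.tan (τ / 2) ^ 2))
        / (3 * Real.tan (τ / 2) ^ 2 + 1) ^ 2) τ := by
  have hD : 3 * Real.tan (τ / 2) ^ 2 + 1 ≠ 0 := by positivity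
  have hsec : 1 / Real.cos (τ / 2) ^ 2 = 1 + Real.tan (τ / 2) ^ 2 := by
    rw [one_div, ← Real.inv_one_add_tan_sq hτ, inv_inv]
  have htan : HasDerivAt (fun u => Real.tan (u / 2)) ((1 + Real.tan (τ / 2) ^ 2) * (1 / 2)) τ := by
    rw [← hsec]
    exact (Real.hasDerivAt_tan hτ).comp τ ((hasDerivAt_id τ).div_const 2)
  refine ((hasDerivAt_const τ (3 * H)).fun_div
    (((htan.fun_pow 2).const_mul 3).add_const 1) hD).congr_deriv ?_
  congr 1
  push_cast
  ring

/-- The exceptional m-critical model with `a·H² = 4/9`, `H > 0`: the function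
`S(τ) = 3H/(3·tan²(τ/2) + 1)` is differentiable wherever `cos(τ/2) ≠ 0` and satisfies the
conformal variational equation `S'² + (a/3)·S⁴ − S² − H·S = 0` there. -/
theorem stmt_7 (H : ℝ) (hH : H > 0) (a : ℝ) (ha : a = 4 / (9 * H ^ 2))
    (τ : ℝ) (hτ : Real.cos (τ / 2) ≠ 0) :
    DifferentiableAt ℝ (fun u => 3 * H / (3 * Real.tan (u / 2) ^ 2 + 1)) τ ∧
      (deriv (fun u => 3 * H / (3 * Real.tan (u / 2) ^ 2 + 1)) τ) ^ 2
        + a / 3 * ((fun u => 3 * H / (3 * Real.tan (u / 2) ^ 2 + 1)) τ) ^ 4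
        - ((fun u => 3 * H / (3 * Real.tan (u / 2) ^ 2 + 1)) τ) ^ 2
        - H * (fun u => 3 * H / (3 * Real.tan (u / 2) ^ 2 + 1)) τ = 0 := by
  have hS := hasDerivAt_div_three_mul_tan_half_sq_add_one H hτ
  refine ⟨hS.differentiableAt, ?_⟩
  rw [hS.deriv, ha]
  have hD : 3 * Real.tan (τ / 2) ^ 2 + 1 ≠ 0 := by positivity
  have hH0 : H ≠ 0 := hH.ne'
  field_simp
  ring
end

section
/- Let H < 0, Λ ∈ ℝ, and set S(τ) = −(H/2)·(1 + cosh τ). Define the conformal energy density m̃(τ) = (3/(8π))·(S'(τ)²/S(τ)⁴ + 1/S(τ)² − Λ/3). Then m̃(τ) ≥ 0 for all τ ∈ ℝ if and only if Λ ≤ 0. -/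
open Real

theorem hasDerivAt_const_mul_one_add_cosh (k τ : ℝ) :
    HasDerivAt (fun t => k * (1 + Real.cosh t)) (k * Real.sinh τ) τ :=
  ((Real.hasDerivAt_cosh τ).const_add 1).const_mul k

theorem sq_const_mul_sinh_le (k τ : ℝ) :
    (k * Real.sinh τ) ^ 2 ≤ (k * (1 + Real.cosh τ)) ^ 2 := by
  rw [mul_pow, mul_pow]
  refine mul_le_mul_of_nonneg_left ?_ (sq_nonneg k)
  nlinarith [Real.cosh_sq τ, Real.one_le_cosh τ]

theorem exists_lt_const_mul_one_add_cosh {k : ℝ} (hk : 0 < k) (x : ℝ) :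
    ∃ τ : ℝ, x < k * (1 + Real.cosh τ) := by
  refine ⟨Real.arsinh (x / k), ?_⟩
  have h := Real.sinh_lt_cosh (Real.arsinh (x / k))
  rw [Real.sinh_arsinh, div_lt_iff₀ hk] at h
  linarith

/-- For the exceptional m-critical model `S(τ) = −(H/2)·(1 + cosh τ)` with `H < 0`, the
conformal energy density `m̃` is everywhere nonnegative if and only if `Λ ≤ 0`. -/
theorem stmt_9 (H : ℝ) (hH : H < 0) (Λ : ℝ)
    (S : ℝ → ℝ) (hS : S = fun τ => -(H / 2) * (1 + Real.cosh τ))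
    (m : ℝ → ℝ)
    (hm : ∀ τ : ℝ, m τ = 3 / (8 * π) *
      ((deriv S τ) ^ 2 / (S τ) ^ 4 + 1 / (S τ) ^ 2 - Λ / 3)) :
    (∀ τ : ℝ, m τ ≥ 0) ↔ Λ ≤ 0 := by
  have hk : 0 < -(H / 2) := by linarith
  have hSd : ∀ τ, (deriv S τ) ^ 2 ≤ (S τ) ^ 2 := fun τ => by
    rw [hS, (hasDerivAt_const_mul_one_add_cosh _ τ).deriv]
    exact sq_const_mul_sinh_le _ τ
  have hc : 0 < 3 / (8 * π) := by positivity
  constructor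
  · intro h
    by_contra! hΛ
    obtain ⟨τ, hτ⟩ := exists_lt_const_mul_one_add_cosh hk (1 + 6 / Λ)
    replace hτ : 1 + 6 / Λ < S τ := by rw [hS]; exact hτ
    have hq : 0 < 6 / Λ := by positivity
    have hpos : 0 < S τ := by linarith
    have hm0 := nonneg_of_mul_nonneg_right (hm τ ▸ h τ) hc
    have hle : (deriv S τ) ^ 2 / (S τ) ^ 4 ≤ 1 / (S τ) ^ 2 := by
      rw [div_le_div_iff₀ (by positivity) (by positivity)]
      nlinarith [mul_le_mul_of_nonneg_right (hSd τ) (sq_nonneg (S τ))]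
    have hbound : Λ / 6 ≤ 1 / (S τ) ^ 2 := by linarith
    have hlt : 6 / Λ < (S τ) ^ 2 := by nlinarith
    rw [div_le_div_iff₀ (by norm_num) (by positivity)] at hbound
    rw [div_lt_iff₀ hΛ] at hlt
    linarith
  · intro hΛ τ
    rw [hm τ]
    have h₁ : 0 ≤ (deriv S τ) ^ 2 / (S τ) ^ 4 := by positivity
    have h₂ : 0 ≤ 1 / (S τ) ^ 2 := by positivity
    exact mul_nonneg hc.le (by linarith)
end

section
/- Let H < 0, Λ ≤ 0, and set S(τ) = −(H/2)·(1 + cosh τ). Define m̃(τ) = (3/(8π))·(S'(τ)²/S(τ)⁴ + 1/S(τ)² − Λ/3) and p̃(τ) = −(1/(4π·S(τ)))·(S''(τ)/S(τ)² − S'(τ)²/(2·S(τ)³) + 1/(2·S(τ)) − Λ·S(τ)/2). Then for every τ ∈ ℝ: −m̃(τ) ≤ p̃(τ) ≤ m̃(τ) (the weak and dominant energy conditions hold), while p̃(τ) < −m̃(τ)/3 (the strong energy condition fails at every point). -/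
open Real

theorem deriv_const_mul_one_add_cosh (k : ℝ) :
    deriv (fun τ => k * (1 + Real.cosh τ)) = fun τ => k * Real.sinh τ :=
  funext fun τ => (((Real.hasDerivAt_cosh τ).const_add 1).const_mul k).deriv

theorem deriv_const_mul_sinh (k : ℝ) :
    deriv (fun τ => k * Real.sinh τ) = fun τ => k * Real.cosh τ :=
  funext fun τ => ((Real.hasDerivAt_sinh τ).const_mul k).deriv

/-- For the exceptional m-critical model `S(τ) = −(H/2)·(1 + cosh τ)` with `H < 0` and
`Λ ≤ 0`: the weak and dominant energy conditions hold everywhere, while the strong energy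
condition fails at every point. -/
theorem stmt_10 (H : ℝ) (hH : H < 0) (Λ : ℝ) (hΛ : Λ ≤ 0)
    (S : ℝ → ℝ) (hS : S = fun τ => -(H / 2) * (1 + Real.cosh τ))
    (m p : ℝ → ℝ)
    (hm : ∀ τ : ℝ, m τ = 3 / (8 * π) *
      ((deriv S τ) ^ 2 / (S τ) ^ 4 + 1 / (S τ) ^ 2 - Λ / 3))
    (hp : ∀ τ : ℝ, p τ = -(1 / (4 * π * S τ)) *
      (deriv (deriv S) τ / (S τ) ^ 2 - (deriv S τ) ^ 2 / (2 * (S τ) ^ 3)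
        + 1 / (2 * S τ) - Λ * S τ / 2)) :
    ∀ τ : ℝ, (-m τ ≤ p τ ∧ p τ ≤ m τ) ∧ p τ < -m τ / 3 := by
  intro τ
  obtain ⟨k, hk⟩ : ∃ k, k = -(H / 2) := ⟨_, rfl⟩
  have hk0 : 0 < k := by linarith
  rw [← hk] at hS
  have hm' := hm τ
  have hp' := hp τ
  rw [hS, deriv_const_mul_one_add_cosh] at hm'
  rw [hS, deriv_const_mul_one_add_cosh, deriv_const_mul_sinh] at hp'
  simp only [mul_pow, Real.sinh_sq] at hm' hp'
  have hc : 1 ≤ Real.cosh τ := Real.one_le_cosh τ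
  generalize Real.cosh τ = c at hm' hp' hc
  have hc0 : 0 < 1 + c := by linarith
  have hπ := Real.pi_pos
  obtain ⟨y, hy⟩ : ∃ y, y = 1 / (k ^ 2 * (1 + c) ^ 3) := ⟨_, rfl⟩
  have hy0 : 0 < y := by rw [hy]; positivity
  have hm₁ : 8 * π * m τ = 6 * c * y - Λ := by
    rw [hm', hy]
    field_simp
    ring
  have hp₁ : 8 * π * p τ = -2 * (c + 1) * y + Λ := by
    rw [hp', hy]
    field_simp
    ring
  have hcy : y ≤ c * y := le_mul_of_one_le_left hy0.le hc
  have h8 : 0 < 8 * π := by positivity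
  refine ⟨⟨?_, ?_⟩, ?_⟩
  · refine le_of_mul_le_mul_left ?_ h8
    linarith
  · refine le_of_mul_le_mul_left ?_ h8
    linarith
  · refine lt_of_mul_lt_mul_left ?_ h8.le
    linarith
end

section
/- Let H > 0, Λ ∈ ℝ, and set S(τ) = H·sinh²(τ/2). Define m̃(τ) = (3/(8π))·(S'(τ)²/S(τ)⁴ + 1/S(τ)² − Λ/3) and p̃(τ) = −(1/(4π·S(τ)))·(S''(τ)/S(τ)² − S'(τ)²/(2·S(τ)³) + 1/(2·S(τ)) − Λ·S(τ)/2). Then the strong energy condition −m̃(τ)/3 ≤ p̃(τ) ≤ m̃(τ) holds for all τ ≠ 0 if and only if Λ = 0. -/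
open Real

theorem deriv_mul_sinh_half_sq (H : ℝ) :
    deriv (fun τ : ℝ => H * Real.sinh (τ / 2) ^ 2) =
      fun τ => H * (Real.sinh (τ / 2) * Real.cosh (τ / 2)) := by
  funext τ
  have h := (((hasDerivAt_id τ).div_const 2).sinh.pow 2).const_mul H
  refine HasDerivAt.deriv (h.congr_deriv ?_)
  simp only [id, Nat.cast_ofNat]
  ring

theorem deriv_mul_sinh_half_mul_cosh_half (H : ℝ) :
    deriv (fun τ : ℝ => H * (Real.sinh (τ / 2) * Real.cosh (τ / 2))) =
      fun τ => H * (1 + 2 * Real.sinh (τ / 2) ^ 2) / 2 := by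
  funext τ
  have h2 := (hasDerivAt_id τ).div_const 2
  have h := (h2.sinh.mul h2.cosh).const_mul H
  refine HasDerivAt.deriv (h.congr_deriv ?_)
  simp only [id]
  linear_combination H / 2 * Real.cosh_sq (τ / 2)

/-- The strong energy condition at a point, in terms of `s = sinh (τ / 2)` and
`c = cosh (τ / 2)`. -/
theorem strong_energy_iff {H s c Λ m p : ℝ} (hH : 0 < H) (hs : s ≠ 0) (hc : c ^ 2 = s ^ 2 + 1)
    (hm : m = 3 / (8 * π) *
      ((H * (s * c)) ^ 2 / (H * s ^ 2) ^ 4 + 1 / (H * s ^ 2) ^ 2 - Λ / 3))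
    (hp : p = -(1 / (4 * π * (H * s ^ 2))) *
      (H * (1 + 2 * s ^ 2) / 2 / (H * s ^ 2) ^ 2 - (H * (s * c)) ^ 2 / (2 * (H * s ^ 2) ^ 3)
        + 1 / (2 * (H * s ^ 2)) - Λ * (H * s ^ 2) / 2)) :
    (-m / 3 ≤ p ∧ p ≤ m) ↔
      -3 ≤ 2 * (Λ * H ^ 2) * (s ^ 2) ^ 3 ∧
        2 * (Λ * H ^ 2) * (s ^ 2) ^ 3 ≤ 3 + 8 * s ^ 2 := by
  have h1 : p - -m / 3 =
      (2 * (Λ * H ^ 2) * (s ^ 2) ^ 3 - -3) / (24 * (π * H ^ 2 * (s ^ 2) ^ 3)) := by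
    rw [hm, hp]
    simp only [mul_pow, hc]
    field_simp
    ring
  have h2 : m - p =
      (3 + 8 * s ^ 2 - 2 * (Λ * H ^ 2) * (s ^ 2) ^ 3) / (8 * (π * H ^ 2 * (s ^ 2) ^ 3)) := by
    rw [hm, hp]
    simp only [mul_pow, hc]
    field_simp
    ring
  rw [← sub_nonneg, h1, ← sub_nonneg (b := p), h2, le_div_iff₀ (by positivity),
    le_div_iff₀ (by positivity), zero_mul, zero_mul, sub_nonneg, sub_nonneg]

theorem eq_zero_of_cubic_bounds {k : ℝ}
    (h : ∀ x : ℝ, 0 < x → -3 ≤ k * x ^ 3 ∧ k * x ^ 3 ≤ 3 + 8 * x) : k = 0 := by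
  rcases lt_trichotomy k 0 with hk | hk | hk
  · have hq : 0 < 3 / -k := div_pos three_pos (neg_pos.2 hk)
    have hx := (h (1 + 3 / -k) (by linarith)).1
    have hkq : k * (3 / -k) = -3 := by
      have := hk.ne
      field_simp
    have h3 : (1 + 3 / -k) ≤ (1 + 3 / -k) ^ 3 := le_self_pow₀ (by linarith) three_ne_zero
    nlinarith [mul_le_mul_of_nonpos_left h3 hk.le]
  · exact hk
  · have hq : 0 < 11 / k := by positivity
    have hx := (h (1 + 11 / k) (by linarith)).2
    have hkq : k * (11 / k) = 11 := by field_simp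
    generalize 11 / k = q at *
    have hkx : k * (1 + q) ^ 3 = (k + 11) * (1 + q) ^ 2 := by
      linear_combination (1 + q) ^ 2 * hkq
    nlinarith [mul_pos hk (pow_pos (by linarith : 0 < 1 + q) 2)]

/-- For the exceptional m-critical model `S(τ) = H·sinh²(τ/2)` with `H > 0`, the strong
energy condition `−m̃/3 ≤ p̃ ≤ m̃` holds at every `τ ≠ 0` if and only if `Λ = 0`. -/
theorem stmt_12 (H : ℝ) (hH : H > 0) (Λ : ℝ)
    (S : ℝ → ℝ) (hS : S = fun τ => H * Real.sinh (τ / 2) ^ 2)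
    (m p : ℝ → ℝ)
    (hm : ∀ τ : ℝ, m τ = 3 / (8 * π) *
      ((deriv S τ) ^ 2 / (S τ) ^ 4 + 1 / (S τ) ^ 2 - Λ / 3))
    (hp : ∀ τ : ℝ, p τ = -(1 / (4 * π * S τ)) *
      (deriv (deriv S) τ / (S τ) ^ 2 - (deriv S τ) ^ 2 / (2 * (S τ) ^ 3)
        + 1 / (2 * S τ) - Λ * S τ / 2)) :
    (∀ τ : ℝ, τ ≠ 0 → -m τ / 3 ≤ p τ ∧ p τ ≤ m τ) ↔ Λ = 0 := by
  subst hS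
  simp only [deriv_mul_sinh_half_sq, deriv_mul_sinh_half_mul_cosh_half] at hm hp
  have key : ∀ τ : ℝ, τ ≠ 0 → ((-m τ / 3 ≤ p τ ∧ p τ ≤ m τ) ↔
      -3 ≤ 2 * (Λ * H ^ 2) * (Real.sinh (τ / 2) ^ 2) ^ 3 ∧
        2 * (Λ * H ^ 2) * (Real.sinh (τ / 2) ^ 2) ^ 3 ≤ 3 + 8 * Real.sinh (τ / 2) ^ 2) :=
    fun τ hτ => strong_energy_iff hH (by simpa using hτ)
      (Real.cosh_sq _) (hm τ) (hp τ)
  constructor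
  · intro h
    have hk : 2 * (Λ * H ^ 2) = 0 := by
      refine eq_zero_of_cubic_bounds fun x hx => ?_
      have hτ : 2 * Real.arsinh (√x) ≠ 0 := by
        simpa [Real.arsinh_eq_zero_iff] using (Real.sqrt_pos.2 hx).ne'
      have := (key _ hτ).1 (h _ hτ)
      rwa [mul_div_cancel_left₀ _ two_ne_zero, Real.sinh_arsinh, Real.sq_sqrt hx.le] at this
    simpa [hH.ne'] using hk
  · rintro rfl τ hτ
    rw [key τ hτ]
    constructor
    · norm_num
    · simp only [zero_mul, mul_zero]
      positivity
end

section
/- Let θ ∈ (−π/3, 0) and define e₁(θ) = (1/(4√3))·(cos θ/√3 − sin θ), e₂(θ) = (1/(4√3))·(cos θ/√3 + sin θ), and e₃(θ) = −e₁(θ) − e₂(θ). Then e₁(θ), e₂(θ), e₃(θ) are roots of the cubic polynomial P(x) = 4x³ − x/12 + cos(3θ)/216, and they satisfy e₃(θ) < e₂(θ) < 1/12 < e₁(θ), e₁(θ) > 0, e₃(θ) < 0, and 4·(e₁(θ)² + e₁(θ)·e₂(θ) + e₂(θ)²) = 1/12. -/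
open Real

/-- The triple-angle formula in Weierstrass form:
`cos φ / 6` is a root of `4x³ − x/12 − cos(3φ)/216`. -/
theorem cos_div_six_isRoot (φ : ℝ) :
    4 * (cos φ / 6) ^ 3 - cos φ / 6 / 12 - cos (3 * φ) / 216 = 0 := by
  rw [cos_three_mul]
  ring

/-- For `θ ∈ (−π/3, 0)`, the numbers `e₁(θ), e₂(θ), e₃(θ)` are roots of the cubic
`P(x) = 4x³ − x/12 + cos(3θ)/216` and satisfy `e₃ < e₂ < 1/12 < e₁`, `e₁ > 0`, `e₃ < 0`,
and `4(e₁² + e₁e₂ + e₂²) = 1/12`. -/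
theorem stmt_13 (θ : ℝ) (hθ : θ ∈ Set.Ioo (-(π / 3)) 0)
    (e₁ e₂ e₃ : ℝ)
    (he₁ : e₁ = 1 / (4 * Real.sqrt 3) * (Real.cos θ / Real.sqrt 3 - Real.sin θ))
    (he₂ : e₂ = 1 / (4 * Real.sqrt 3) * (Real.cos θ / Real.sqrt 3 + Real.sin θ))
    (he₃ : e₃ = -e₁ - e₂) :
    (4 * e₁ ^ 3 - e₁ / 12 + Real.cos (3 * θ) / 216 = 0) ∧
    (4 * e₂ ^ 3 - e₂ / 12 + Real.cos (3 * θ) / 216 = 0) ∧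
    (4 * e₃ ^ 3 - e₃ / 12 + Real.cos (3 * θ) / 216 = 0) ∧
    e₃ < e₂ ∧ e₂ < 1 / 12 ∧ (1 : ℝ) / 12 < e₁ ∧
    e₁ > 0 ∧ e₃ < 0 ∧
    4 * (e₁ ^ 2 + e₁ * e₂ + e₂ ^ 2) = 1 / 12 := by
  obtain ⟨hl, hr⟩ := hθ
  have h3 : √3 ^ 2 = 3 := sq_sqrt (by norm_num)
  have h₁ : e₁ = cos (θ + π / 3) / 6 := by
    rw [he₁, cos_add, cos_pi_div_three, sin_pi_div_three]
    field_simp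
    linear_combination (4 * √3 * sin θ - 4 * cos θ) * h3
  have h₂ : e₂ = cos (π / 3 - θ) / 6 := by
    rw [he₂, cos_sub, cos_pi_div_three, sin_pi_div_three]
    field_simp
    linear_combination (-4 * √3 * sin θ - 4 * cos θ) * h3
  have h₃ : e₃ = -cos θ / 6 := by
    rw [he₃, h₁, h₂, cos_add, cos_sub, cos_pi_div_three]
    ring
  have r₁ : cos (3 * (θ + π / 3)) = -cos (3 * θ) := by
    rw [← cos_add_pi]
    ring_nf
  have r₂ : cos (3 * (π / 3 - θ)) = -cos (3 * θ) := by
    rw [← cos_pi_sub]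
    ring_nf
  have lt₁ : 1 / 2 < cos (θ + π / 3) := by
    rw [← cos_pi_div_three]
    exact cos_lt_cos_of_nonneg_of_le_pi (by linarith) (by linarith) (by linarith)
  have lt₂ : cos (π / 3 - θ) < 1 / 2 := by
    rw [← cos_pi_div_three]
    exact cos_lt_cos_of_nonneg_of_le_pi (by linarith) (by linarith) (by linarith)
  have lt₃ : -cos θ < cos (π / 3 - θ) := by
    rw [← cos_neg θ, ← cos_pi_sub]
    exact cos_lt_cos_of_nonneg_of_le_pi (by linarith) (by linarith) (by linarith)
  have pos : 0 < cos θ := cos_pos_of_mem_Ioo ⟨by linarith [pi_pos], by linarith [pi_pos]⟩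
  refine ⟨?_, ?_, ?_, by linarith, by linarith, by linarith, by linarith, by linarith, ?_⟩
  · have := cos_div_six_isRoot (θ + π / 3)
    rw [h₁]
    linarith
  · have := cos_div_six_isRoot (π / 3 - θ)
    rw [h₂]
    linarith
  · rw [h₃, cos_three_mul]
    ring
  · rw [h₁, h₂, cos_add, cos_sub, cos_pi_div_three, sin_pi_div_three]
    linear_combination (sin θ ^ 2 / 36) * h3 + (1 / 12) * sin_sq_add_cos_sq θ
end

section
/- Let θ ∈ (−π/3, 0) and let e₂(θ) = (1/(4√3))·(cos θ/√3 + sin θ). Suppose Q : ℝ → ℝ is differentiable at τ and satisfies Q'(τ)² = 4·Q(τ)³ − Q(τ)/12 + cos(3θ)/216 and Q(τ) < 1/12. Then −cos θ/6 ≤ Q(τ) ≤ e₂(θ). -/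
open Real

/-- For `θ ∈ (−π/3, 0)`: if `Q` solves the Weierstrass-type equation
`Q'² = 4Q³ − Q/12 + cos(3θ)/216` at `τ` and `Q τ < 1/12`, then
`−cos θ/6 ≤ Q τ ≤ e₂(θ)`. -/
theorem stmt_14 (θ : ℝ) (hθ : θ ∈ Set.Ioo (-(π / 3)) 0)
    (e₂ : ℝ)
    (he₂ : e₂ = 1 / (4 * Real.sqrt 3) * (Real.cos θ / Real.sqrt 3 + Real.sin θ))
    (Q : ℝ → ℝ) (τ : ℝ) (hQdiff : DifferentiableAt ℝ Q τ)
    (hQ : (deriv Q τ) ^ 2 = 4 * (Q τ) ^ 3 - Q τ / 12 + Real.cos (3 * θ) / 216)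
    (hQlt : Q τ < 1 / 12) :
    -Real.cos θ / 6 ≤ Q τ ∧ Q τ ≤ e₂ := by
  obtain ⟨h1, h2⟩ := hθ
  have hs : Real.sin θ < 0 := Real.sin_neg_of_neg_of_neg_pi_lt h2 (by linarith [Real.pi_pos])
  have hc : 1 / 2 < Real.cos θ := by
    rw [← Real.cos_pi_div_three, ← Real.cos_neg θ]
    exact Real.cos_lt_cos_of_nonneg_of_le_pi (by linarith) (by linarith [Real.pi_pos])
      (by linarith)
  have hsc := Real.sin_sq_add_cos_sq θ
  have hr : Real.sqrt 3 ^ 2 = 3 := Real.sq_sqrt (by norm_num)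
  have hr0 : 0 < Real.sqrt 3 := by positivity
  have hr1 : 1 < Real.sqrt 3 := by nlinarith
  have he : e₂ = (Real.cos θ + Real.sqrt 3 * Real.sin θ) / 12 := by
    rw [he₂]
    field_simp
    rw [hr]
    ring
  rw [Real.cos_three_mul] at hQ
  generalize Real.sqrt 3 = r at *
  generalize Real.cos θ = c at *
  generalize Real.sin θ = s at *
  generalize Q τ = x at *
  have hfac : 4 * x ^ 3 - x / 12 + (4 * c ^ 3 - 3 * c) / 216
      = 4 * ((c - r * s) / 12 - x) * ((x + c / 6) * (e₂ - x)) := by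
    rw [he]
    linear_combination (s ^ 2 * (x + c / 6) / 36) * hr + (x + c / 6) / 12 * hsc
  have hlarge : 1 / 12 < (c - r * s) / 12 := by
    have h3 : 1 < c - s := by nlinarith
    nlinarith
  have hprod : 0 ≤ (x + c / 6) * (e₂ - x) := by
    refine nonneg_of_mul_nonneg_right (a := 4 * ((c - r * s) / 12 - x)) ?_ (by linarith)
    rw [← hfac, ← hQ]
    positivity
  have horder : -c / 6 < e₂ := by
    have h4 : (r * s) ^ 2 < (3 * c) ^ 2 := by
      rw [mul_pow, hr]
      nlinarith
    have h5 := abs_lt_of_sq_lt_sq' h4 (by linarith)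
    linarith [h5.1]
  constructor
  · by_contra! h
    nlinarith
  · by_contra! h
    nlinarith
end

section
/- Let θ ∈ (−π/3, 0), H < 0, and Λ ≤ (1 − cos θ − √3·sin θ)²/(3·H²). Set a = (2/(9·H²))·(1 − cos 3θ). If Q : ℝ → ℝ is differentiable at τ with Q'(τ)² = 4·Q(τ)³ − Q(τ)/12 + cos(3θ)/216 and Q(τ) < 1/12, then the conformal energy density m̃(τ) = (1/(8π))·((1 − 12·Q(τ))²·(5 + 12·Q(τ))/(9·H²) − a − Λ) is nonnegative. -/
open Real

/-- The real cubic `x³ - 3x + 2 cos 3θ` splits, with roots `-2 cos θ` and `cos θ ± √3 sin θ`. -/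
lemma cubic_add_two_mul_cos_three_mul (θ x : ℝ) :
    x ^ 3 - 3 * x + 2 * cos (3 * θ) =
      (x + 2 * cos θ) * (x - (cos θ + √3 * sin θ)) * (x - (cos θ - √3 * sin θ)) := by
  have h3 : √3 ^ 2 = 3 := Real.sq_sqrt (by norm_num)
  rw [cos_three_mul]
  linear_combination (3 * x + 6 * cos θ) * Real.sin_sq_add_cos_sq θ +
    (x + 2 * cos θ) * sin θ ^ 2 * h3

/-- For `θ ∈ (-π/3, 0)`, a point `x < 1` at which `x³ - 3x + 2 cos 3θ` is nonnegative is at most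
the middle root. -/
lemma le_cos_add_sqrt_three_mul_sin {θ x : ℝ} (hθ : θ ∈ Set.Ioo (-(π / 3)) 0) (hx : x < 1)
    (h : 0 ≤ x ^ 3 - 3 * x + 2 * cos (3 * θ)) : x ≤ cos θ + √3 * sin θ := by
  obtain ⟨hl, hr⟩ := hθ
  have hs : sin θ < 0 := sin_neg_of_neg_of_neg_pi_lt hr (by linarith [pi_pos])
  have hc : 1 / 2 < cos θ := by
    rw [← cos_pi_div_three, ← cos_neg θ]
    exact cos_lt_cos_of_nonneg_of_le_pi (by linarith) (by linarith [pi_pos]) (by linarith)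
  have hc1 : cos θ < 1 := by nlinarith [Real.sin_sq_add_cos_sq θ]
  have hsq : (√3 * sin θ) ^ 2 = 3 * (1 - cos θ ^ 2) := by
    rw [mul_pow, Real.sq_sqrt (by norm_num), Real.sin_sq]
  have hneg : √3 * sin θ < 0 := mul_neg_of_pos_of_neg (by positivity) hs
  have hlarge : 1 < cos θ - √3 * sin θ := by nlinarith
  have hsmall : -2 * cos θ < cos θ + √3 * sin θ := by nlinarith
  rw [cubic_add_two_mul_cos_three_mul] at h
  by_contra! hlt
  have h₁ : 0 < (x + 2 * cos θ) * (x - (cos θ + √3 * sin θ)) :=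
    mul_pos (by linarith) (by linarith)
  exact absurd h (not_le.mpr (mul_neg_of_pos_of_neg h₁ (by linarith)))

/-- Class I, `H < 0`: if `Λ ≤ (1 − cos θ − √3·sin θ)²/(3H²)` and `Q` solves
`Q'² = 4Q³ − Q/12 + cos(3θ)/216` at `τ` with `Q τ < 1/12`, then the conformal energy
density `m̃(τ)` is nonnegative. -/
theorem stmt_15 (θ : ℝ) (hθ : θ ∈ Set.Ioo (-(π / 3)) 0)
    (H : ℝ) (hH : H < 0) (Λ : ℝ)
    (hΛ : Λ ≤ (1 - Real.cos θ - Real.sqrt 3 * Real.sin θ) ^ 2 / (3 * H ^ 2))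
    (a : ℝ) (ha : a = 2 / (9 * H ^ 2) * (1 - Real.cos (3 * θ)))
    (Q : ℝ → ℝ) (τ : ℝ) (hQdiff : DifferentiableAt ℝ Q τ)
    (hQ : (deriv Q τ) ^ 2 = 4 * (Q τ) ^ 3 - Q τ / 12 + Real.cos (3 * θ) / 216)
    (hQlt : Q τ < 1 / 12) :
    1 / (8 * π) * ((1 - 12 * Q τ) ^ 2 * (5 + 12 * Q τ) / (9 * H ^ 2) - a - Λ) ≥ 0 := by
  have hcubic : 0 ≤ (12 * Q τ) ^ 3 - 3 * (12 * Q τ) + 2 * cos (3 * θ) := by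
    nlinarith [sq_nonneg (deriv Q τ)]
  have hle := le_cos_add_sqrt_three_mul_sin hθ (by linarith) hcubic
  have hmid : cos θ + √3 * sin θ ≤ 1 := by
    have hs : sin θ < 0 := sin_neg_of_neg_of_neg_pi_lt hθ.2 (by linarith [hθ.1, pi_pos])
    have := mul_neg_of_pos_of_neg (show 0 < √3 by positivity) hs
    linarith [cos_le_one θ]
  have hsq : (1 - cos θ - √3 * sin θ) ^ 2 ≤ (1 - 12 * Q τ) ^ 2 :=
    pow_le_pow_left₀ (by linarith) (by linarith) 2
  have hH2 : 0 < 9 * H ^ 2 := by have := sq_pos_of_neg hH; positivity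
  have hsplit : (1 - 12 * Q τ) ^ 2 * (5 + 12 * Q τ) / (9 * H ^ 2) - a -
      (1 - cos θ - √3 * sin θ) ^ 2 / (3 * H ^ 2) =
      ((12 * Q τ) ^ 3 - 3 * (12 * Q τ) + 2 * cos (3 * θ) +
        3 * ((1 - 12 * Q τ) ^ 2 - (1 - cos θ - √3 * sin θ) ^ 2)) / (9 * H ^ 2) := by
    have := hH.ne
    rw [ha]
    field_simp
    ring
  have hnonneg : 0 ≤ ((12 * Q τ) ^ 3 - 3 * (12 * Q τ) + 2 * cos (3 * θ) +
      3 * ((1 - 12 * Q τ) ^ 2 - (1 - cos θ - √3 * sin θ) ^ 2)) / (9 * H ^ 2) :=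
    div_nonneg (by linarith) hH2.le
  exact mul_nonneg (by positivity) (by linarith)
end

section
/- Let θ ∈ (−π/3, 0), H < 0, and Λ ∈ ℝ. Set a = (2/(9·H²))·(1 − cos 3θ). If Q : ℝ → ℝ is differentiable at τ with Q'(τ)² = 4·Q(τ)³ − Q(τ)/12 + cos(3θ)/216 and Q(τ) < 1/12, then the weak energy condition holds at τ: m̃(τ) + p̃(τ) ≥ 0, where m̃(τ) = (1/(8π))·((1 − 12·Q(τ))²·(5 + 12·Q(τ))/(9·H²) − a − Λ) and p̃(τ) = (1/(4π))·((a + Λ)/2 − (12·Q(τ) − 1)²/(9·H²)). In fact m̃(τ) + p̃(τ) = (12·Q(τ) − 1)²·(12·Q(τ) + 3)/(72·π·H²). -/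
open Real

/-- Class I, `H < 0`: the weak energy condition holds: `m̃ + p̃ ≥ 0`; in fact
`m̃ + p̃ = (12Q − 1)²·(12Q + 3)/(72πH²)`. -/
theorem stmt_16 (θ : ℝ) (hθ : θ ∈ Set.Ioo (-(π / 3)) 0)
    (H : ℝ) (hH : H < 0) (Λ : ℝ)
    (a : ℝ) (ha : a = 2 / (9 * H ^ 2) * (1 - Real.cos (3 * θ)))
    (Q : ℝ → ℝ) (τ : ℝ) (hQdiff : DifferentiableAt ℝ Q τ)
    (hQ : (deriv Q τ) ^ 2 = 4 * (Q τ) ^ 3 - Q τ / 12 + Real.cos (3 * θ) / 216)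
    (hQlt : Q τ < 1 / 12)
    (m p : ℝ)
    (hm : m = 1 / (8 * π) * ((1 - 12 * Q τ) ^ 2 * (5 + 12 * Q τ) / (9 * H ^ 2) - a - Λ))
    (hp : p = 1 / (4 * π) * ((a + Λ) / 2 - (12 * Q τ - 1) ^ 2 / (9 * H ^ 2))) :
    m + p ≥ 0 ∧
      m + p = (12 * Q τ - 1) ^ 2 * (12 * Q τ + 3) / (72 * π * H ^ 2) := by
  have hQge : -1 / 4 ≤ Q τ := by
    by_contra! h
    nlinarith [sq_nonneg (deriv Q τ), Real.cos_le_one (3 * θ),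
      pow_pos (sub_pos.2 h) 2, pow_pos (sub_pos.2 h) 3]
  have hsum : m + p = (12 * Q τ - 1) ^ 2 * (12 * Q τ + 3) / (72 * π * H ^ 2) := by
    have hH0 : H ≠ 0 := hH.ne
    rw [hm, hp]
    field_simp
    ring
  refine ⟨?_, hsum⟩
  have hfactor : 0 ≤ 12 * Q τ + 3 := by linarith
  rw [hsum, ge_iff_le]
  positivity
end

section
/- Let θ ∈ (−π/3, 0), H < 0, and Λ ≤ (2/(9·H²))·sin²(θ/2)·(7 + cos θ − 2·cos 2θ − 5√3·sin θ). Set a = (2/(9·H²))·(1 − cos 3θ). If Q : ℝ → ℝ is differentiable at τ with Q'(τ)² = 4·Q(τ)³ − Q(τ)/12 + cos(3θ)/216 and Q(τ) < 1/12, then m̃(τ) − p̃(τ) ≥ 0, where m̃(τ) = (1/(8π))·((1 − 12·Q(τ))²·(5 + 12·Q(τ))/(9·H²) − a − Λ) and p̃(τ) = (1/(4π))·((a + Λ)/2 − (12·Q(τ) − 1)²/(9·H²)). -/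
open Real

/-- The cubic `7 - 13 x + 5 x ^ 2 + x ^ 3 = (1 - x) ^ 2 * (7 + x)` is antitone on `[-2, 1]`. -/
lemma sq_one_sub_mul_antitone {x e : ℝ} (hx : -2 ≤ x) (hxe : x ≤ e) (he : e ≤ 1) :
    (1 - e) ^ 2 * (7 + e) ≤ (1 - x) ^ 2 * (7 + x) := by
  have h : -13 + 5 * (x + e) + (x ^ 2 + x * e + e ^ 2) ≤ 0 := by
    nlinarith [mul_nonneg (by linarith : 0 ≤ x + 2) (by linarith : 0 ≤ 1 - x),
      mul_nonneg (by linarith : 0 ≤ e + 2) (by linarith : 0 ≤ 1 - e),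
      mul_nonneg (by linarith : 0 ≤ x + 2) (by linarith : 0 ≤ 1 - e)]
  nlinarith [mul_nonneg (sub_nonneg.2 hxe) (neg_nonneg.2 h)]

/-- Below `1`, nonnegativity of `x ^ 3 - 3 * x + 2 * cos (3 * θ)` confines `x` to the interval
between the two smaller roots. -/
lemma mem_Icc_of_cubic_nonneg {c s r x : ℝ} (hr : r ^ 2 = 3) (hr0 : 0 < r)
    (hcs : s ^ 2 + c ^ 2 = 1) (hc : 1 / 2 < c) (hs : s < 0) (hx : x < 1)
    (h : 0 ≤ x ^ 3 - 3 * x + 2 * (4 * c ^ 3 - 3 * c)) :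
    x ∈ Set.Icc (-2 * c) (c + r * s) := by
  have hr1 : 1 < r := by nlinarith
  have hc1 : c < 1 := by nlinarith
  have hg : 1 < c - r * s := by
    have : 1 - c < -s := by nlinarith
    nlinarith
  have he : 0 < 3 * c + r * s := by
    have h1 : (r * s) ^ 2 < (3 * c) ^ 2 := by
      rw [mul_pow, hr]; nlinarith
    linarith [(abs_lt_of_sq_lt_sq' h1 (by linarith)).1]
  have hfac : x ^ 3 - 3 * x + 2 * (4 * c ^ 3 - 3 * c)
      = (x + 2 * c) * (x - (c + r * s)) * (x - (c - r * s)) := by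
    linear_combination (x + 2 * c) * s ^ 2 * hr + 3 * (x + 2 * c) * hcs
  have hprod : (x + 2 * c) * (x - (c + r * s)) ≤ 0 := by
    by_contra! hpos
    rw [hfac] at h
    nlinarith [mul_pos hpos (by linarith : 0 < c - r * s - x)]
  constructor
  · by_contra! hlt
    nlinarith [mul_pos (by linarith : 0 < -(x + 2 * c)) (by linarith : 0 < c + r * s - x)]
  · by_contra! hlt
    nlinarith [mul_pos (by linarith : 0 < x + 2 * c) (by linarith : 0 < x - (c + r * s))]

/-- Class I, `H < 0`: if `Λ ≤ (2/(9H²))·sin²(θ/2)·(7 + cos θ − 2cos 2θ − 5√3·sin θ)`, then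
`m̃ − p̃ ≥ 0` (the upper half of the dominant energy condition). -/
theorem stmt_17 (θ : ℝ) (hθ : θ ∈ Set.Ioo (-(π / 3)) 0)
    (H : ℝ) (hH : H < 0) (Λ : ℝ)
    (hΛ : Λ ≤ 2 / (9 * H ^ 2) * Real.sin (θ / 2) ^ 2 *
      (7 + Real.cos θ - 2 * Real.cos (2 * θ) - 5 * Real.sqrt 3 * Real.sin θ))
    (a : ℝ) (ha : a = 2 / (9 * H ^ 2) * (1 - Real.cos (3 * θ)))
    (Q : ℝ → ℝ) (τ : ℝ) (hQdiff : DifferentiableAt ℝ Q τ)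
    (hQ : (deriv Q τ) ^ 2 = 4 * (Q τ) ^ 3 - Q τ / 12 + Real.cos (3 * θ) / 216)
    (hQlt : Q τ < 1 / 12)
    (m p : ℝ)
    (hm : m = 1 / (8 * π) * ((1 - 12 * Q τ) ^ 2 * (5 + 12 * Q τ) / (9 * H ^ 2) - a - Λ))
    (hp : p = 1 / (4 * π) * ((a + Λ) / 2 - (12 * Q τ - 1) ^ 2 / (9 * H ^ 2))) :
    m - p ≥ 0 := by
  obtain ⟨hθ1, hθ2⟩ := hθ
  have hπ := Real.pi_pos
  have hs : Real.sin θ < 0 := Real.sin_neg_of_neg_of_neg_pi_lt hθ2 (by linarith)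
  have hc : 1 / 2 < Real.cos θ := by
    rw [← Real.cos_pi_div_three, ← Real.cos_neg θ]
    exact Real.cos_lt_cos_of_nonneg_of_le_pi (by linarith) (by linarith) (by linarith)
  have hcs := Real.sin_sq_add_cos_sq θ
  have hhalf : Real.sin (θ / 2) ^ 2 = (1 - Real.cos θ) / 2 := by
    have h := Real.cos_two_mul (θ / 2)
    rw [show 2 * (θ / 2) = θ by ring] at h
    have h' := Real.sin_sq_add_cos_sq (θ / 2)
    linarith
  have hr : Real.sqrt 3 ^ 2 = 3 := Real.sq_sqrt (by norm_num)
  have hr0 : 0 < Real.sqrt 3 := Real.sqrt_pos.2 (by norm_num)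
  rw [Real.cos_three_mul] at ha hQ
  rw [hhalf, Real.cos_two_mul] at hΛ
  generalize Real.sqrt 3 = r at *
  generalize Real.cos θ = c at *
  generalize Real.sin θ = s at *
  obtain ⟨hx1, hx2⟩ := mem_Icc_of_cubic_nonneg (x := 12 * Q τ) hr hr0 hcs hc hs (by linarith)
    (by nlinarith [sq_nonneg (deriv Q τ)])
  have hc1 : c ≤ 1 := by nlinarith
  have hmono := sq_one_sub_mul_antitone (by linarith) hx2 (by nlinarith)
  have hval : (1 - (c + r * s)) ^ 2 * (7 + (c + r * s)) = 4 * (1 - (4 * c ^ 3 - 3 * c))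
      + 4 * ((1 - c) / 2) * (7 + c - 2 * (2 * c ^ 2 - 1) - 5 * r * s) := by
    linear_combination (s ^ 2 * (5 + 3 * c + r * s)) * hr + (15 + 9 * c + 3 * r * s) * hcs
  have hH2 : 0 < 9 * H ^ 2 := mul_pos (by norm_num) (sq_pos_of_neg hH)
  rw [hval] at hmono
  have hdiff : m - p = 1 / (8 * π) *
      ((1 - 12 * Q τ) ^ 2 * (7 + 12 * Q τ) / (9 * H ^ 2) - 2 * a - 2 * Λ) := by
    rw [hm, hp]
    field_simp
    ring
  have hdiv := div_le_div_of_nonneg_right hmono hH2.le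
  have hsplit : (4 * (1 - (4 * c ^ 3 - 3 * c))
      + 4 * ((1 - c) / 2) * (7 + c - 2 * (2 * c ^ 2 - 1) - 5 * r * s)) / (9 * H ^ 2)
      = 2 * a + 2 * (2 / (9 * H ^ 2) * ((1 - c) / 2) *
        (7 + c - 2 * (2 * c ^ 2 - 1) - 5 * r * s)) := by
    rw [ha]
    ring
  rw [hdiff]
  exact mul_nonneg (by positivity) (by linarith)
end

section
/- Let θ > 0, H ≠ 0, and set a = (2/(9·H²))·(1 + cosh 3θ). Suppose Q : ℝ → ℝ is differentiable at τ and satisfies Q'(τ)² = 4·Q(τ)³ − Q(τ)/12 − cosh(3θ)/216. Then: (i) Q(τ) ≥ cosh θ/6; and (ii) if moreover Λ ≤ (1 − 2·cosh θ)²/(3·H²), then the conformal energy density m̃(τ) = (1/(8π))·((1 − 12·Q(τ))²·(5 + 12·Q(τ))/(9·H²) − a − Λ) is nonnegative. -/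
open Real

/-- Class II, negative type: if `Q` solves `Q'² = 4Q³ − Q/12 − cosh(3θ)/216` at `τ`, then
(i) `Q τ ≥ cosh θ/6`, and (ii) if `Λ ≤ (1 − 2cosh θ)²/(3H²)`, the conformal energy density
`m̃(τ) = (1/(8π))·((1 − 12Q)²(5 + 12Q)/(9H²) − a − Λ)` is nonnegative, where
`a = (2/(9H²))·(1 + cosh 3θ)`. -/
theorem stmt_19 (θ : ℝ) (hθ : θ > 0) (H : ℝ) (hH : H ≠ 0)
    (a : ℝ) (ha : a = 2 / (9 * H ^ 2) * (1 + Real.cosh (3 * θ)))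
    (Q : ℝ → ℝ) (τ : ℝ) (hQdiff : DifferentiableAt ℝ Q τ)
    (hQ : (deriv Q τ) ^ 2 = 4 * (Q τ) ^ 3 - Q τ / 12 - Real.cosh (3 * θ) / 216) :
    Q τ ≥ Real.cosh θ / 6 ∧
      (∀ Λ : ℝ, Λ ≤ (1 - 2 * Real.cosh θ) ^ 2 / (3 * H ^ 2) →
        1 / (8 * π) * ((1 - 12 * Q τ) ^ 2 * (5 + 12 * Q τ) / (9 * H ^ 2) - a - Λ) ≥ 0) := by
  have hc : 1 < cosh θ := one_lt_cosh.mpr hθ.ne'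
  rw [cosh_three_mul] at ha hQ
  generalize cosh θ = c at *
  generalize Q τ = q at *
  have hq : c / 6 ≤ q := by
    have hpos : 0 < (12 * q + c) ^ 2 + 3 * (c ^ 2 - 1) := by nlinarith [sq_nonneg (12 * q + c)]
    have hprod : 0 ≤ (6 * q - c) * ((12 * q + c) ^ 2 + 3 * (c ^ 2 - 1)) := by
      nlinarith [sq_nonneg (deriv Q τ)]
    linarith [nonneg_of_mul_nonneg_left hprod hpos]
  refine ⟨hq, fun Λ hΛ => ?_⟩
  have hnum : 0 ≤ (1 - 12 * q) ^ 2 * (5 + 12 * q) - 2 * (1 + (4 * c ^ 3 - 3 * c))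
      - 3 * (1 - 2 * c) ^ 2 := by
    have hfac : 0 ≤ (6 * q - c) *
        (8 * ((6 * q) ^ 2 + 6 * q * c + c ^ 2) + 12 * (6 * q + c) - 18) :=
      mul_nonneg (by linarith) (by nlinarith)
    linarith
  have hdens : 0 ≤ (1 - 12 * q) ^ 2 * (5 + 12 * q) / (9 * H ^ 2) - a
      - (1 - 2 * c) ^ 2 / (3 * H ^ 2) := by
    have heq : (1 - 12 * q) ^ 2 * (5 + 12 * q) / (9 * H ^ 2) - a
        - (1 - 2 * c) ^ 2 / (3 * H ^ 2) = ((1 - 12 * q) ^ 2 * (5 + 12 * q)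
        - 2 * (1 + (4 * c ^ 3 - 3 * c)) - 3 * (1 - 2 * c) ^ 2) / (9 * H ^ 2) := by
      rw [ha]
      field_simp
      ring
    rw [heq]
    positivity
  exact mul_nonneg (by positivity) (by linarith)
end
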